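/- Let W be a real random variable following the Gamma distribution G(a, b) with shape a > 0 and scale b > 0. Then E[Q(√W)] = (1/π) ∫_0^{π/2} (1 + b/(2 sin²θ))^{−a} dθ. -/

import Mathlib

open MeasureTheory ProbabilityTheory

/-- The density of the Gamma distribution `G(a, b)` with shape `a` and scale `b`:
`f(x) = x^(a-1) e^(-x/b) / (b^a Γ(a))` for `x > 0` and `0` for `x ≤ 0`. -/
noncomputable def gammaPdf (a b x : ℝ) : ℝ :=
  if 0 < x then x ^ (a - 1) * Real.exp (-x / b) / (b ^ a * Real.Gamma a) else 0

/-- A real random variable `X` on `(α, μ)` follows the Gamma distribution `G(a, b)`: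
its law has density `gammaPdf a b` with respect to Lebesgue measure. -/
def HasGammaLaw {α : Type*} [MeasurableSpace α] (μ : Measure α) (X : α → ℝ) (a b : ℝ) : Prop :=
  Measure.map X μ = volume.withDensity (fun x => ENNReal.ofReal (gammaPdf a b x))


/-- The Gaussian Q-function: `Q(x) = ∫_x^∞ (1/√(2π)) e^(−t²/2) dt`. -/
noncomputable def gaussQ (x : ℝ) : ℝ :=
  ∫ t in Set.Ioi x, (1 / Real.sqrt (2 * Real.pi)) * Real.exp (-t ^ 2 / 2)

/-- The integral of `y e^(-c y²/2)` over a half-line, as a lower Lebesgue integral. -/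
lemma lintegral_Ioi_mul_exp_neg_mul_sq {c x : ℝ} (hc : 0 < c) (hx : 0 ≤ x) :
    ∫⁻ y in Set.Ioi x, ENNReal.ofReal (y * Real.exp (-(c * y ^ 2 / 2))) =
      ENNReal.ofReal (Real.exp (-(c * x ^ 2 / 2)) / c) := by
  have hderiv : ∀ y ∈ Set.Ici x, HasDerivAt (fun y => -Real.exp (-(c * y ^ 2 / 2)) / c)
      (y * Real.exp (-(c * y ^ 2 / 2))) y := by
    intro y _
    have h := (((((hasDerivAt_pow 2 y).const_mul c).div_const 2).fun_neg.exp).fun_neg).div_const c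
    refine h.congr_deriv ?_
    push_cast
    field_simp
  have hnonneg : ∀ y ∈ Set.Ioi x, 0 ≤ y * Real.exp (-(c * y ^ 2 / 2)) := fun y hy =>
    mul_nonneg (hx.trans (le_of_lt hy)) (Real.exp_pos _).le
  have hlim : Filter.Tendsto (fun y : ℝ => -Real.exp (-(c * y ^ 2 / 2)) / c) Filter.atTop
      (nhds 0) := by
    have h1 : Filter.Tendsto (fun y : ℝ => c * y ^ 2 / 2) Filter.atTop Filter.atTop :=
      ((Filter.tendsto_pow_atTop two_ne_zero).const_mul_atTop hc).atTop_div_const two_pos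
    have h2 := ((Real.tendsto_exp_neg_atTop_nhds_zero.comp h1).neg).div_const c
    simpa using h2
  have hint := integrableOn_Ioi_deriv_of_nonneg' hderiv hnonneg hlim
  rw [← ofReal_integral_eq_lintegral_ofReal hint
    ((ae_restrict_iff' measurableSet_Ioi).mpr (Filter.Eventually.of_forall hnonneg)),
    integral_Ioi_of_hasDerivAt_of_nonneg' hderiv hnonneg hlim]
  congr 1
  ring

/-- The Gaussian integral over `(0, ∞)`, as a lower Lebesgue integral, with a prefactor. -/
lemma lintegral_Ioi_mul_exp_neg_one_add_sq {y : ℝ} (hy : 0 < y) :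
    ∫⁻ t in Set.Ioi (0 : ℝ), ENNReal.ofReal (y * Real.exp (-((1 + t ^ 2) * y ^ 2 / 2))) =
      ENNReal.ofReal (Real.sqrt (2 * Real.pi) / 2 * Real.exp (-y ^ 2 / 2)) := by
  have hb : 0 < y ^ 2 / 2 := by positivity
  have hfun : (fun t : ℝ => y * Real.exp (-((1 + t ^ 2) * y ^ 2 / 2))) =
      fun t => (y * Real.exp (-y ^ 2 / 2)) * Real.exp (-(y ^ 2 / 2) * t ^ 2) := by
    funext t
    rw [mul_assoc, ← Real.exp_add]
    congr 2
    ring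
  have hint : IntegrableOn (fun t : ℝ => y * Real.exp (-((1 + t ^ 2) * y ^ 2 / 2)))
      (Set.Ioi 0) := by
    rw [hfun]
    exact ((integrable_exp_neg_mul_sq hb).const_mul _).integrableOn
  rw [← ofReal_integral_eq_lintegral_ofReal hint
    (Filter.Eventually.of_forall fun t => by positivity), hfun, integral_const_mul,
    integral_gaussian_Ioi]
  congr 1
  have h : Real.sqrt (Real.pi / (y ^ 2 / 2)) = Real.sqrt (2 * Real.pi) / y := by
    rw [show Real.pi / (y ^ 2 / 2) = 2 * Real.pi / y ^ 2 by field_simp,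
      Real.sqrt_div (by positivity), Real.sqrt_sq hy.le]
  rw [h]
  field_simp

/-- Craig's formula for the Gaussian Q-function, in the variable `t = cot θ`. -/
lemma ofReal_gaussQ_eq_lintegral {x : ℝ} (hx : 0 ≤ x) :
    ENNReal.ofReal (gaussQ x) = ∫⁻ t in Set.Ioi (0 : ℝ),
      ENNReal.ofReal (1 / (Real.pi * (1 + t ^ 2)) * Real.exp (-((1 + t ^ 2) * x ^ 2 / 2))) := by
  have hpi := Real.pi_pos
  have hsq : Real.sqrt (2 * Real.pi) ^ 2 = 2 * Real.pi := Real.sq_sqrt (by positivity)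
  have hspos : 0 < Real.sqrt (2 * Real.pi) := Real.sqrt_pos.mpr (by positivity)
  have hint : Integrable (fun t : ℝ =>
      (1 / Real.sqrt (2 * Real.pi)) * Real.exp (-t ^ 2 / 2)) := by
    have h := (integrable_exp_neg_mul_sq (b := 1 / 2) (by norm_num)).const_mul
      (1 / Real.sqrt (2 * Real.pi))
    refine h.congr (Filter.Eventually.of_forall fun t => ?_)
    simp only
    congr 2
    ring
  symm
  calc
    _ = ∫⁻ t in Set.Ioi (0 : ℝ), ∫⁻ y in Set.Ioi x, ENNReal.ofReal (1 / Real.pi) *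
          ENNReal.ofReal (y * Real.exp (-((1 + t ^ 2) * y ^ 2 / 2))) := by
      refine lintegral_congr fun t => ?_
      rw [lintegral_const_mul _ (by fun_prop),
        lintegral_Ioi_mul_exp_neg_mul_sq (by positivity) hx,
        ← ENNReal.ofReal_mul (by positivity)]
      congr 1
      field_simp
    _ = ∫⁻ y in Set.Ioi x, ∫⁻ t in Set.Ioi (0 : ℝ), ENNReal.ofReal (1 / Real.pi) *
          ENNReal.ofReal (y * Real.exp (-((1 + t ^ 2) * y ^ 2 / 2))) :=
      lintegral_lintegral_swap (by fun_prop)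
    _ = ∫⁻ y in Set.Ioi x,
          ENNReal.ofReal ((1 / Real.sqrt (2 * Real.pi)) * Real.exp (-y ^ 2 / 2)) := by
      refine setLIntegral_congr_fun measurableSet_Ioi fun y hy => ?_
      rw [lintegral_const_mul _ (by fun_prop),
        lintegral_Ioi_mul_exp_neg_one_add_sq (hx.trans_lt hy),
        ← ENNReal.ofReal_mul (by positivity)]
      congr 1
      field_simp
      rw [mul_comm Real.pi 2, hsq]
    _ = ENNReal.ofReal (gaussQ x) := by
      rw [gaussQ, ofReal_integral_eq_lintegral_ofReal hint.integrableOn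
        (Filter.Eventually.of_forall fun t => by positivity)]

lemma measurable_gammaPdf (a b : ℝ) : Measurable (gammaPdf a b) := by
  unfold gammaPdf
  exact Measurable.ite measurableSet_Ioi (by fun_prop) measurable_const

/-- The Laplace transform of the Gamma distribution. -/
lemma HasGammaLaw.lintegral_exp_neg_mul_sqrt_sq {α : Type*} [MeasurableSpace α] {μ : Measure α}
    {W : α → ℝ} {a b s : ℝ} (hW : HasGammaLaw μ W a b) (ha : 0 < a) (hb : 0 < b)
    (hmeas : Measurable W) (hs : 0 ≤ s) :
    ∫⁻ ω, ENNReal.ofReal (Real.exp (-(s * Real.sqrt (W ω) ^ 2))) ∂μ =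
      ENNReal.ofReal ((1 + b * s) ^ (-a)) := by
  have hr : 0 < 1 / b + s := by positivity
  have hG := Real.Gamma_pos_of_pos ha
  have hval := Real.integral_rpow_mul_exp_neg_mul_Ioi ha hr
  have hint : IntegrableOn (fun x : ℝ => x ^ (a - 1) * Real.exp (-((1 / b + s) * x)))
      (Set.Ioi 0) := by
    refine Integrable.of_integral_ne_zero ?_
    rw [hval]
    positivity
  have hmap := lintegral_map (μ := μ)
    (f := fun x : ℝ => ENNReal.ofReal (Real.exp (-(s * Real.sqrt x ^ 2)))) (by fun_prop) hmeas
  rw [← hmap, hW, lintegral_withDensity_eq_lintegral_mul _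
    (measurable_gammaPdf a b).ennreal_ofReal (by fun_prop)]
  calc
    _ = ∫⁻ x in Set.Ioi (0 : ℝ), ENNReal.ofReal (1 / (b ^ a * Real.Gamma a) *
          (x ^ (a - 1) * Real.exp (-((1 / b + s) * x)))) := by
      rw [← lintegral_indicator measurableSet_Ioi]
      refine lintegral_congr fun x => ?_
      by_cases hx : 0 < x
      · rw [Set.indicator_of_mem (Set.mem_Ioi.mpr hx), Pi.mul_apply, gammaPdf, if_pos hx,
          Real.sq_sqrt hx.le, ← ENNReal.ofReal_mul (by positivity)]
        congr 1
        rw [show -((1 / b + s) * x) = -x / b + -(s * x) by ring, Real.exp_add]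
        ring
      · rw [Set.indicator_of_notMem (by simpa using hx), Pi.mul_apply, gammaPdf, if_neg hx]
        simp
    _ = ENNReal.ofReal ((1 + b * s) ^ (-a)) := by
      rw [← ofReal_integral_eq_lintegral_ofReal (hint.const_mul _)
        ((ae_restrict_iff' measurableSet_Ioi).mpr (Filter.Eventually.of_forall
          fun x (hx : 0 < x) => by positivity)), integral_const_mul, hval]
      congr 1
      rw [show 1 + b * s = b * (1 / b + s) by field_simp, Real.rpow_neg (by positivity),
        Real.mul_rpow hb.le hr.le, Real.div_rpow zero_le_one hr.le, Real.one_rpow]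
      field_simp

/-- The change of variables `t = cot θ` from `(0, π/2)` to `(0, ∞)`. -/
lemma intervalIntegral_zero_pi_div_two_eq_integral_Ioi (g : ℝ → ℝ) :
    ∫ θ in (0 : ℝ)..(Real.pi / 2), g (Real.sin θ ^ 2) =
      ∫ t in Set.Ioi (0 : ℝ), 1 / (1 + t ^ 2) * g (1 / (1 + t ^ 2)) := by
  have himage : (fun t : ℝ => Real.pi / 2 - Real.arctan t) '' Set.Ioi 0 =
      Set.Ioo 0 (Real.pi / 2) := by
    ext θ
    constructor
    · rintro ⟨t, ht, rfl⟩
      have h1 := Real.arctan_pos.mpr ht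
      have h2 := Real.arctan_lt_pi_div_two t
      exact ⟨by linarith, by linarith⟩
    · rintro ⟨h1, h2⟩
      refine ⟨Real.tan (Real.pi / 2 - θ), ?_, ?_⟩
      · exact Real.tan_pos_of_pos_of_lt_pi_div_two (by linarith) (by linarith)
      · simp only
        rw [Real.arctan_tan (by linarith) (by linarith)]
        ring
  have hderiv : ∀ t ∈ Set.Ioi (0 : ℝ), HasDerivWithinAt
      (fun t : ℝ => Real.pi / 2 - Real.arctan t) (-(1 / (1 + t ^ 2))) (Set.Ioi 0) t :=
    fun t _ => ((Real.hasDerivAt_arctan t).const_sub _).hasDerivWithinAt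
  have hinj : Set.InjOn (fun t : ℝ => Real.pi / 2 - Real.arctan t) (Set.Ioi 0) :=
    fun s _ t _ h => Real.arctan_injective (by simpa using h)
  rw [intervalIntegral.integral_of_le (by positivity), integral_Ioc_eq_integral_Ioo, ← himage,
    integral_image_eq_integral_abs_deriv_smul measurableSet_Ioi hderiv hinj]
  refine integral_congr_ae (Filter.Eventually.of_forall fun t => ?_)
  have h : (0 : ℝ) < 1 / (1 + t ^ 2) := by positivity
  simp only [Real.sin_pi_div_two_sub, Real.cos_sq_arctan, abs_neg, abs_of_pos h, smul_eq_mul]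

/-- For a Gamma random variable `W ~ G(a, b)`,
`E[Q(√W)] = (1/π) ∫_0^{π/2} (1 + b/(2 sin²θ))^(−a) dθ`. -/
theorem expectation_gaussQ_sqrt_gamma
    {α : Type*} [MeasurableSpace α] (μ : Measure α) [IsProbabilityMeasure μ]
    (W : α → ℝ) (a b : ℝ) (ha : 0 < a) (hb : 0 < b)
    (hmeas : Measurable W)
    (hW : HasGammaLaw μ W a b) :
    ∫ ω, gaussQ (Real.sqrt (W ω)) ∂μ =
      (1 / Real.pi) *
        ∫ θ in (0 : ℝ)..(Real.pi / 2), (1 + b / (2 * Real.sin θ ^ 2)) ^ (-a) := by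
  have hQ : ∀ x : ℝ, 0 ≤ gaussQ x := fun x => integral_nonneg fun t => by positivity
  have hmeasQ : Measurable fun ω => gaussQ (Real.sqrt (W ω)) := by
    have h : (fun ω => gaussQ (Real.sqrt (W ω))) = fun ω =>
        (∫⁻ t in Set.Ioi (0 : ℝ), ENNReal.ofReal (1 / (Real.pi * (1 + t ^ 2)) *
          Real.exp (-((1 + t ^ 2) * Real.sqrt (W ω) ^ 2 / 2)))).toReal := by
      funext ω
      rw [← ofReal_gaussQ_eq_lintegral (Real.sqrt_nonneg _), ENNReal.toReal_ofReal (hQ _)]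
    rw [h]
    refine (Measurable.lintegral_prod_right' (f := fun p : α × ℝ =>
      ENNReal.ofReal (1 / (Real.pi * (1 + p.2 ^ 2)) *
        Real.exp (-((1 + p.2 ^ 2) * Real.sqrt (W p.1) ^ 2 / 2)))) ?_).ennreal_toReal
    fun_prop
  rw [integral_eq_lintegral_of_nonneg_ae (Filter.Eventually.of_forall fun ω => hQ _)
    hmeasQ.aestronglyMeasurable, intervalIntegral_zero_pi_div_two_eq_integral_Ioi
    (fun u => (1 + b / (2 * u)) ^ (-a)), ← integral_const_mul,
    integral_eq_lintegral_of_nonneg_ae (Filter.Eventually.of_forall fun t => by positivity)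
      (by fun_prop)]
  congr 1
  simp_rw [ofReal_gaussQ_eq_lintegral (Real.sqrt_nonneg _)]
  rw [lintegral_lintegral_swap (by fun_prop)]
  refine lintegral_congr fun t => ?_
  have hsplit : ∀ ω, ENNReal.ofReal (1 / (Real.pi * (1 + t ^ 2)) *
      Real.exp (-((1 + t ^ 2) * Real.sqrt (W ω) ^ 2 / 2))) =
      ENNReal.ofReal (1 / (Real.pi * (1 + t ^ 2))) *
        ENNReal.ofReal (Real.exp (-((1 + t ^ 2) / 2 * Real.sqrt (W ω) ^ 2))) := by
    intro ω
    rw [← ENNReal.ofReal_mul (by positivity)]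
    congr 3
    ring
  simp_rw [hsplit]
  rw [lintegral_const_mul _ (by fun_prop),
    hW.lintegral_exp_neg_mul_sqrt_sq ha hb hmeas (by positivity),
    ← ENNReal.ofReal_mul (by positivity)]
  congr 1
  rw [show b / (2 * (1 / (1 + t ^ 2))) = b * ((1 + t ^ 2) / 2) by field_simp]
  field_simp
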